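/- Let S : ℝ × [0,T) → ℝ be a C⁴ function, 2π-periodic in θ, with S_θθ + S > 0 on ℝ × [0,T), satisfying S_tt = ((S_θt)² − 1)·k where k = 1/(S_θθ + S), with initial data S(θ,0) = h(θ) and S_t(θ,0) = −f̃(θ) where f̃ ≥ 0 and (f̃'(θ))² < 1 for all θ. Then the normal velocity σ̃ = −S_t satisfies (σ̃_θ(θ,t))² − 1 < 0, i.e. (S_θt(θ,t))² < 1, for all (θ,t) ∈ ℝ × [0,T). -/

import Mathlib

open Real Set Function

/-- Partial derivative in the first (angle) variable. -/
noncomputable def pdθ (S : ℝ → ℝ → ℝ) : ℝ → ℝ → ℝ := fun θ t => deriv (fun y => S y t) θ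

/-- Partial derivative in the second (time) variable. -/
noncomputable def pdt (S : ℝ → ℝ → ℝ) : ℝ → ℝ → ℝ := fun θ t => deriv (fun s => S θ s) t

/-- The curvature `k = 1/(S_θθ + S)` of the convex curve with support function `S(·,t)`. -/
noncomputable def curv (S : ℝ → ℝ → ℝ) : ℝ → ℝ → ℝ :=
  fun θ t => 1 / (pdθ (pdθ S) θ t + S θ t)

theorem hasDerivAt_fst_of_contDiff {F : ℝ → ℝ → ℝ} (hF : ContDiff ℝ 1 (uncurry F)) (θ t : ℝ) :
    HasDerivAt (fun y => F y t) (fderiv ℝ (uncurry F) (θ, t) (1, 0)) θ :=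
  (hF.differentiable one_ne_zero (θ, t)).hasFDerivAt.comp_hasDerivAt (f := fun y => (y, t)) θ
    ((hasDerivAt_id θ).prodMk (hasDerivAt_const θ t))

theorem hasDerivAt_snd_of_contDiff {F : ℝ → ℝ → ℝ} (hF : ContDiff ℝ 1 (uncurry F)) (θ t : ℝ) :
    HasDerivAt (fun s => F θ s) (fderiv ℝ (uncurry F) (θ, t) (0, 1)) t :=
  (hF.differentiable one_ne_zero (θ, t)).hasFDerivAt.comp_hasDerivAt (f := fun s => (θ, s)) t
    ((hasDerivAt_const t θ).prodMk (hasDerivAt_id t))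

theorem uncurry_pdθ {F : ℝ → ℝ → ℝ} (hF : ContDiff ℝ 1 (uncurry F)) :
    uncurry (pdθ F) = fun p => fderiv ℝ (uncurry F) p (1, 0) :=
  funext fun p => (hasDerivAt_fst_of_contDiff hF p.1 p.2).deriv

theorem uncurry_pdt {F : ℝ → ℝ → ℝ} (hF : ContDiff ℝ 1 (uncurry F)) :
    uncurry (pdt F) = fun p => fderiv ℝ (uncurry F) p (0, 1) :=
  funext fun p => (hasDerivAt_snd_of_contDiff hF p.1 p.2).deriv

theorem hasDerivAt_pdθ {F : ℝ → ℝ → ℝ} (hF : ContDiff ℝ 1 (uncurry F)) (θ t : ℝ) :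
    HasDerivAt (fun y => F y t) (pdθ F θ t) θ :=
  (hasDerivAt_fst_of_contDiff hF θ t).differentiableAt.hasDerivAt

theorem hasDerivAt_pdt {F : ℝ → ℝ → ℝ} (hF : ContDiff ℝ 1 (uncurry F)) (θ t : ℝ) :
    HasDerivAt (fun s => F θ s) (pdt F θ t) t :=
  (hasDerivAt_snd_of_contDiff hF θ t).differentiableAt.hasDerivAt

theorem contDiff_uncurry_pdθ {F : ℝ → ℝ → ℝ} {m n : WithTop ℕ∞} (hF : ContDiff ℝ n (uncurry F))
    (hmn : m + 1 ≤ n) : ContDiff ℝ m (uncurry (pdθ F)) := by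
  rw [uncurry_pdθ (hF.of_le (le_add_self.trans hmn))]
  exact (hF.fderiv_right hmn).clm_apply contDiff_const

theorem contDiff_uncurry_pdt {F : ℝ → ℝ → ℝ} {m n : WithTop ℕ∞} (hF : ContDiff ℝ n (uncurry F))
    (hmn : m + 1 ≤ n) : ContDiff ℝ m (uncurry (pdt F)) := by
  rw [uncurry_pdt (hF.of_le (le_add_self.trans hmn))]
  exact (hF.fderiv_right hmn).clm_apply contDiff_const

/-- Equality of mixed partial derivatives for a `C²` function. -/
theorem pdt_pdθ_comm {F : ℝ → ℝ → ℝ} (hF : ContDiff ℝ 2 (uncurry F)) :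
    pdt (pdθ F) = pdθ (pdt F) := by
  have h12 : (1 : WithTop ℕ∞) + 1 ≤ 2 := by norm_num
  have hF1 : ContDiff ℝ 1 (uncurry F) := hF.of_le (by norm_num)
  have hsymm (p : ℝ × ℝ) : IsSymmSndFDerivAt ℝ (uncurry F) p :=
    hF.contDiffAt.isSymmSndFDerivAt (by simp)
  have hd : Differentiable ℝ (fderiv ℝ (uncurry F)) :=
    (hF.fderiv_right h12).differentiable one_ne_zero
  funext θ t
  have h1 := congrFun (uncurry_pdt (contDiff_uncurry_pdθ hF h12)) (θ, t)
  have h2 := congrFun (uncurry_pdθ (contDiff_uncurry_pdt hF h12)) (θ, t)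
  rw [uncurry_pdθ hF1, fderiv_clm_apply (hd _) (differentiableAt_const _)] at h1
  rw [uncurry_pdt hF1, fderiv_clm_apply (hd _) (differentiableAt_const _)] at h2
  simp only [uncurry_apply_pair, fderiv_fun_const, Pi.zero_apply, ContinuousLinearMap.comp_zero,
    zero_add, ContinuousLinearMap.flip_apply] at h1 h2
  rw [h1, h2]
  exact hsymm (θ, t) _ _

theorem pdθ_add_period {F : ℝ → ℝ → ℝ} {L : ℝ} (hF : ∀ θ t, F (θ + L) t = F θ t) (θ t : ℝ) :
    pdθ F (θ + L) t = pdθ F θ t := by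
  simp only [pdθ, ← deriv_comp_add_const, hF]

theorem pdt_add_period {F : ℝ → ℝ → ℝ} {L : ℝ} (hF : ∀ θ t, F (θ + L) t = F θ t) (θ t : ℝ) :
    pdt F (θ + L) t = pdt F θ t := by
  simp only [pdt, hF]

/-- At a minimum over `[a, b]` other than the left endpoint, the derivative is nonpositive. -/
theorem HasDerivAt.nonpos_of_isMinOn_Icc {g : ℝ → ℝ} {g' a b x : ℝ} (hg : HasDerivAt g g' x)
    (hax : a < x) (hxb : x ≤ b) (hmin : ∀ y ∈ Icc a b, g x ≤ g y) : g' ≤ 0 := by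
  have h := hg.tendsto_slope.mono_left (nhdsLT_le_nhdsNE x)
  refine le_of_tendsto h ?_
  filter_upwards [Ioo_mem_nhdsLT hax] with y hy
  rw [slope_def_field]
  exact div_nonpos_of_nonneg_of_nonpos (sub_nonneg.2 (hmin y ⟨hy.1.le, hy.2.le.trans hxb⟩))
    (sub_nonpos.2 hy.2.le)

/-- Positivity is propagated by a linear homogeneous transport equation on a circle. -/
theorem pos_of_transport {L τ : ℝ} (hL : 0 < L) {P a c : ℝ → ℝ → ℝ}
    (hP : ContDiff ℝ 1 (uncurry P)) (hper : ∀ θ t, P (θ + L) t = P θ t)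
    (hc : ContinuousOn (uncurry c) (Icc 0 L ×ˢ Icc 0 τ))
    (heq : ∀ θ, ∀ t ∈ Icc 0 τ, pdt P θ t = a θ t * pdθ P θ t - c θ t * P θ t)
    (h0 : ∀ θ, 0 < P θ 0) (θ t : ℝ) (ht : t ∈ Icc 0 τ) : 0 < P θ t := by
  have hcompact : IsCompact (Icc (0 : ℝ) L ×ˢ Icc (0 : ℝ) τ) := isCompact_Icc.prod isCompact_Icc
  obtain ⟨C, hC⟩ := hcompact.exists_bound_of_continuousOn hc
  have hred (θ : ℝ) : ∃ y ∈ Icc 0 L, ∀ t, P θ t = P y t := by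
    refine ⟨toIcoMod hL 0 θ, ?_, fun t => ?_⟩
    · have := toIcoMod_mem_Ico hL 0 θ
      rw [zero_add] at this
      exact Ico_subset_Icc_self this
    · have hp : Periodic (fun y => P y t) L := fun y => hper y t
      rw [toIcoMod]
      exact (hp.sub_zsmul_eq _).symm
  have hPc : Continuous (uncurry P) := hP.continuous
  obtain ⟨θ₁, -, hθ₁⟩ := (isCompact_Icc (a := (0 : ℝ)) (b := L)).exists_isMinOn
    (nonempty_Icc.2 hL.le)
    (show Continuous fun θ => P θ 0 from
      hPc.comp (continuous_id.prodMk continuous_const)).continuousOn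
  set ε := P θ₁ 0
  have hε : 0 < ε := h0 θ₁
  set K := C + 1
  -- The barrier `ε * exp (-K t)` is a strict subsolution.
  let u : ℝ → ℝ → ℝ := fun θ t => exp (-K * t) * P θ t - ε * exp (-(2 * K) * t)
  have huc : Continuous (uncurry u) := by
    have : uncurry u = fun p : ℝ × ℝ =>
      exp (-K * p.2) * uncurry P p - ε * exp (-(2 * K) * p.2) := rfl
    rw [this]
    fun_prop
  obtain ⟨⟨θ₀, t₀⟩, ⟨hθ₀, ht₀⟩, hmin⟩ := hcompact.exists_isMinOn
    ⟨(0, t), ⟨le_rfl, hL.le⟩, ht⟩ huc.continuousOn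
  have hmin' (θ t : ℝ) (ht : t ∈ Icc 0 τ) : u θ₀ t₀ ≤ u θ t := by
    obtain ⟨y, hy, hyP⟩ := hred θ
    have : u θ t = u y t := by simp only [u, hyP]
    rw [this]
    exact hmin (show (y, t) ∈ Icc 0 L ×ˢ Icc 0 τ from ⟨hy, ht⟩)
  have hnonneg : 0 ≤ u θ₀ t₀ := by
    by_contra! hneg
    have ht₀pos : 0 < t₀ := by
      refine ht₀.1.lt_of_ne' fun h => ?_
      change t₀ = 0 at h
      have h1 : ε ≤ P θ₀ 0 := hθ₁ hθ₀
      simp only [u, h, mul_zero, exp_zero, one_mul, mul_one] at hneg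
      linarith
    have hθ : pdθ P θ₀ t₀ = 0 := by
      refine IsLocalMin.hasDerivAt_eq_zero (Filter.Eventually.of_forall fun y => ?_)
        (hasDerivAt_pdθ hP θ₀ t₀)
      have := hmin' y t₀ ht₀
      simp only [u, sub_le_sub_iff_right] at this
      exact le_of_mul_le_mul_left this (exp_pos _)
    have hder : HasDerivAt (u θ₀) (-K * exp (-K * t₀) * P θ₀ t₀ + exp (-K * t₀) * pdt P θ₀ t₀
        + 2 * K * ε * exp (-(2 * K) * t₀)) t₀ := by
      have he (r : ℝ) : HasDerivAt (fun s => exp (r * s)) (r * exp (r * t₀)) t₀ := by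
        simpa [mul_comm] using ((hasDerivAt_id t₀).const_mul r).exp
      refine (((he (-K)).mul (hasDerivAt_pdt hP θ₀ t₀)).sub
        ((he (-(2 * K))).const_mul ε)).congr_deriv ?_
      ring
    have hle := hder.nonpos_of_isMinOn_Icc ht₀pos ht₀.2 fun s hs => hmin' θ₀ s hs
    rw [heq θ₀ t₀ ht₀, hθ] at hle
    have hcb := abs_le.1 (hC (θ₀, t₀) ⟨hθ₀, ht₀⟩)
    simp only [uncurry_apply_pair] at hcb
    have h1 : 0 < K + c θ₀ t₀ := by linarith [hcb.1]
    have h2 : 0 < K - c θ₀ t₀ := by linarith [hcb.2]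
    have h3 := mul_pos h1 (neg_pos.2 hneg)
    have h4 := mul_pos h2 (mul_pos hε (exp_pos (-(2 * K) * t₀)))
    simp only [u] at h3
    linarith
  have hu := hnonneg.trans (hmin' θ t ht)
  have h5 := mul_pos hε (exp_pos (-(2 * K) * t))
  simp only [u] at hu
  exact pos_of_mul_pos_right (by linarith) (exp_pos (-K * t)).le

/-- Gradient bound for the normal velocity: along the hyperbolic mean curvature flow
`S_tt = ((S_θt)² − 1)·k` with initial normal velocity `f̃ ≥ 0` satisfying `(f̃')² < 1`,
one has `(σ̃_θ)² − 1 < 0`, i.e. `(S_θt)² < 1`, for all `(θ,t) ∈ ℝ × [0,T)`. -/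
theorem normal_velocity_gradient_bound
    (T : ℝ) (S : ℝ → ℝ → ℝ) (h f : ℝ → ℝ)
    (hS : ContDiff ℝ 4 (uncurry S))
    (hper : ∀ θ t, S (θ + 2 * π) t = S θ t)
    (hconv : ∀ θ t, t ∈ Ico (0:ℝ) T → 0 < pdθ (pdθ S) θ t + S θ t)
    (hpde : ∀ θ t, t ∈ Ico (0:ℝ) T →
      pdt (pdt S) θ t = ((pdθ (pdt S) θ t) ^ 2 - 1) * curv S θ t)
    (hinit : ∀ θ, S θ 0 = h θ)
    (hinitvel : ∀ θ, pdt S θ 0 = - f θ)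
    (hfnonneg : ∀ θ, 0 ≤ f θ)
    (hfgrad : ∀ θ, (deriv f θ) ^ 2 < 1) :
    ∀ θ t, t ∈ Ico (0:ℝ) T → (pdθ (pdt S) θ t) ^ 2 < 1 := by
  intro θ t ht
  set V := pdt S
  set W := pdθ V
  set R : ℝ → ℝ → ℝ := fun θ t => pdθ (pdθ S) θ t + S θ t
  have hV : ContDiff ℝ 3 (uncurry V) := contDiff_uncurry_pdt hS (by norm_num)
  have hW : ContDiff ℝ 2 (uncurry W) := contDiff_uncurry_pdθ hV (by norm_num)
  have hW1 : ContDiff ℝ 1 (uncurry W) := hW.of_le (by norm_num)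
  have hSθ : ContDiff ℝ 3 (uncurry (pdθ S)) := contDiff_uncurry_pdθ hS (by norm_num)
  have hR : ContDiff ℝ 2 (uncurry R) :=
    (contDiff_uncurry_pdθ hSθ (by norm_num)).add (hS.of_le (by norm_num))
  have hR1 : ContDiff ℝ 1 (uncurry R) := hR.of_le (by norm_num)
  have hRθ : ContDiff ℝ 1 (uncurry (pdθ R)) := contDiff_uncurry_pdθ hR (by norm_num)
  let P : ℝ → ℝ → ℝ := fun θ t => 1 - W θ t ^ 2
  have hP : ContDiff ℝ 1 (uncurry P) := contDiff_const.sub (hW1.pow 2)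
  suffices 0 < P θ t from sub_pos.1 this
  have hsub {s : ℝ} (hs : s ∈ Icc 0 t) : s ∈ Ico 0 T := ⟨hs.1, hs.2.trans_lt ht.2⟩
  refine pos_of_transport (τ := t) (a := fun θ t => 2 * W θ t / R θ t)
    (c := fun θ t => 2 * W θ t * pdθ R θ t / R θ t ^ 2) two_pi_pos hP
    (fun θ t => ?_) ?_ (fun θ s hs => ?_) (fun θ => ?_) θ t ⟨ht.1, le_rfl⟩
  · simp only [P, W, V, pdθ_add_period (pdt_add_period hper)]
  · refine ContinuousOn.div (f := fun p : ℝ × ℝ => 2 * uncurry W p * uncurry (pdθ R) p)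
      (g := fun p : ℝ × ℝ => uncurry R p ^ 2) ?_ ?_ ?_
    · exact ((continuous_const.mul hW.continuous).mul hRθ.continuous).continuousOn
    · exact (hR.continuous.pow 2).continuousOn
    · exact fun p hp => pow_ne_zero 2 (hconv p.1 p.2 (hsub hp.2)).ne'
  · have hRne : R θ s ≠ 0 := (hconv θ s (hsub hs)).ne'
    have hWt : pdt W θ s =
        (2 * W θ s * pdθ W θ s * R θ s - (W θ s ^ 2 - 1) * pdθ R θ s) / R θ s ^ 2 := by
      have hcomm : pdt W = pdθ (pdt V) := pdt_pdθ_comm (hV.of_le (by norm_num))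
      have hslice : (fun y => pdt V y s) = fun y => (W y s ^ 2 - 1) / R y s := by
        funext y
        rw [hpde y s (hsub hs), curv, mul_one_div]
      rw [hcomm]
      change deriv (fun y => pdt V y s) θ = _
      rw [hslice]
      refine (((((hasDerivAt_pdθ hW1 θ s).pow 2).sub_const 1).div
        (hasDerivAt_pdθ hR1 θ s) hRne).congr_deriv ?_).deriv
      norm_num
    have hPθ : pdθ P θ s = -(2 * W θ s * pdθ W θ s) := by
      refine ((((hasDerivAt_pdθ hW1 θ s).pow 2).const_sub 1).congr_deriv ?_).deriv
      norm_num
    have hPt : pdt P θ s = -(2 * W θ s * pdt W θ s) := by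
      refine ((((hasDerivAt_pdt hW1 θ s).pow 2).const_sub 1).congr_deriv ?_).deriv
      norm_num
    rw [hPt, hPθ, hWt]
    simp only [P]
    field_simp
    ring
  · have hW0 : W θ 0 = -deriv f θ := by
      change deriv (fun y => V y 0) θ = _
      simp only [hinitvel, deriv.fun_neg]
    simp only [P, hW0, neg_sq]
    exact sub_pos.2 (hfgrad θ)
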